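/- Let x, y ∈ ℝ and let ω be a snake trajectory with initial point x. Define A_s(ω) = ∫₀^s 1{ζ_r(ω) ≤ τ*_y(ω_r)} dr and η_s(ω) = inf{r ≥ 0 : A_r(ω) > s}. Then setting ω'_s = ω_{η_s(ω)} for every s ≥ 0 defines a snake trajectory ω' with initial point x (the truncation of ω at y, denoted tr_y(ω)). -/

import Mathlib

open MeasureTheory

/-- A finite path: a continuous real function defined on the time interval
`[0, lifetime]`, encoded as a function on all of `ℝ` which is constant on
`(-∞, 0]` and on `[lifetime, ∞)` (stopped extension). -/
structure FinPath where
  /-- the lifetime `ζ_(w)` of the path -/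
  lifetime : ℝ
  lifetime_nonneg : 0 ≤ lifetime
  /-- the path itself (extended by stopping outside `[0, lifetime]`) -/
  toFun : ℝ → ℝ
  cont : Continuous toFun
  stopped : ∀ t : ℝ, toFun t = toFun (min (max t 0) lifetime)

namespace FinPath

/-- the endpoint (tip) `ŵ = w(ζ_(w))` of a finite path -/
def tip (w : FinPath) : ℝ := w.toFun w.lifetime

/-- the trivial path at `x`, with zero lifetime; it is identified with the point `x` -/
def triv (x : ℝ) : FinPath :=
  ⟨0, le_refl 0, fun _ => x, continuous_const, fun _ => rfl⟩

/-- the distance `d_W` on finite paths: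
`d_W(w,w') = |ζ_(w) - ζ_(w')| + sup_t |w(t∧ζ_(w)) - w'(t∧ζ_(w'))|`. -/
noncomputable def dW (w w' : FinPath) : ℝ :=
  |w.lifetime - w'.lifetime| + ⨆ t : ℝ, |w.toFun t - w'.toFun t|

/-- the first hitting time `τ*_y(w) = inf {t ∈ (0, ζ_(w)] : w(t) = y}` of `y`,
an extended real number (`⊤ = +∞` if the path does not hit `y` on `(0, ζ_(w)]`). -/
noncomputable def tauStar (y : ℝ) (w : FinPath) : EReal :=
  sInf ((fun t : ℝ => (t : EReal)) '' {t : ℝ | 0 < t ∧ t ≤ w.lifetime ∧ w.toFun t = y})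

/-- the first hitting time `τ_y(w) = inf {t ∈ [0, ζ_(w)] : w(t) = y}` of `y`,
an extended real number (`⊤ = +∞` if the path does not hit `y`). -/
noncomputable def tau (y : ℝ) (w : FinPath) : EReal :=
  sInf ((fun t : ℝ => (t : EReal)) '' {t : ℝ | 0 ≤ t ∧ t ≤ w.lifetime ∧ w.toFun t = y})

end FinPath

/-- `ω` is a snake trajectory with initial point `x`: the time parameter runs over
`[0,∞)` (the map is extended trivially to negative times), `ω_0 = x`, every path `ω_s`
starts at `x`, `ω` is continuous for `d_W`, `σ(ω) = sup {s : ω_s ≠ x} < ∞`, and the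
snake property holds. -/
structure IsSnakeTraj (x : ℝ) (ω : ℝ → FinPath) : Prop where
  init : ∀ s : ℝ, s ≤ 0 → ω s = FinPath.triv x
  start : ∀ s : ℝ, (ω s).toFun 0 = x
  cont : ∀ s : ℝ, ∀ ε > (0:ℝ), ∃ δ > (0:ℝ), ∀ s' : ℝ,
    |s' - s| < δ → FinPath.dW (ω s') (ω s) < ε
  finite : BddAbove {s : ℝ | ω s ≠ FinPath.triv x}
  snake : ∀ s s' : ℝ, 0 ≤ s → s ≤ s' → ∀ t : ℝ, 0 ≤ t →
    t ≤ sInf ((fun r => (ω r).lifetime) '' Set.Icc s s') →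
    (ω s).toFun t = (ω s').toFun t

/-- the duration `σ(ω) = sup {s ≥ 0 : ω_s ≠ ω_0}` of a trajectory
(with the convention `sup ∅ = 0`, which is `Real.sSup`'s convention). -/
noncomputable def sigmaTraj (ω : ℝ → FinPath) : ℝ := sSup {s : ℝ | ω s ≠ ω 0}

/-- the distance `d_S(ω,ω') = |σ(ω) - σ(ω')| + sup_s d_W(ω_s, ω'_s)`
on snake trajectories. -/
noncomputable def dS (ω ω' : ℝ → FinPath) : ℝ :=
  |sigmaTraj ω - sigmaTraj ω'| + ⨆ s : ℝ, FinPath.dW (ω s) (ω' s)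

/-- `(h, f)` is a tree-like path: `h ≥ 0` and `f` are continuous, vanish
(resp. are constant) on `(-∞,0]` (time runs over `[0,∞)`),
`σ_h = sup {s : h s ≠ 0} < ∞`, and whenever `h(s) = h(s') = min_{[s,s']} h`
one has `f(s) = f(s')`. -/
structure IsTreeLike (h f : ℝ → ℝ) : Prop where
  cont_h : Continuous h
  cont_f : Continuous f
  nonneg : ∀ s, 0 ≤ h s
  h_nonpos : ∀ s : ℝ, s ≤ 0 → h s = 0
  f_nonpos : ∀ s : ℝ, s ≤ 0 → f s = f 0
  finite : BddAbove {s : ℝ | h s ≠ 0}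
  treeLike : ∀ s s' : ℝ, 0 ≤ s → s ≤ s' → h s = h s' →
    h s = sInf (h '' Set.Icc s s') → f s = f s'

/-- `σ_h = sup {s : h s ≠ 0}` (with `sup ∅ = 0`). -/
noncomputable def sigmaH (h : ℝ → ℝ) : ℝ := sSup {s : ℝ | h s ≠ 0}

/-- the distance on tree-like paths:
`d_T((h,f),(h',f')) = |σ_h - σ_{h'}| + sup_s (|h s - h' s| + |f s - f' s|)`. -/
noncomputable def dT (h f h' f' : ℝ → ℝ) : ℝ :=
  |sigmaH h - sigmaH h'| + ⨆ s : ℝ, (|h s - h' s| + |f s - f' s|)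

section Trunc

/-- `A_s = ∫_0^s 1{ζ_r(ω) ≤ τ*_y(ω_r)} dr`. -/
noncomputable def truncA (y : ℝ) (ω : ℝ → FinPath) (s : ℝ) : ℝ :=
  ∫ r in (0:ℝ)..s,
    Set.indicator {r : ℝ | ((ω r).lifetime : EReal) ≤ FinPath.tauStar y (ω r)}
      (fun _ => (1:ℝ)) r

/-- `η_s = inf {r ≥ 0 : A_r > s}`. -/
noncomputable def truncEta (y : ℝ) (ω : ℝ → FinPath) (s : ℝ) : ℝ :=
  sInf {r : ℝ | truncA y ω r > s}

/-- the truncation `tr_y(ω)` of `ω` at `y`, defined by `tr_y(ω)_s = ω_{η_s}`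
for `s ≥ 0` (and extended to negative times by the value at `0`). -/
noncomputable def trunc (y : ℝ) (ω : ℝ → FinPath) : ℝ → FinPath :=
  fun s => ω (truncEta y ω (max s 0))

end Trunc

section Sub

private lemma stop_aux (g : ℝ → ℝ) (c L : ℝ) (hL : 0 ≤ L) (t : ℝ) :
    g (c + min (max t 0) L) = g (c + min (max (min (max t 0) L) 0) L) := by
  have h0u : 0 ≤ min (max t 0) L := le_min (le_max_right t 0) hL
  rw [max_eq_left h0u, min_eq_left (min_le_right _ _)]

/-- the time index `(a + s) ∧ b` (with `s` clamped to `[0,∞)`). -/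
def subIdx (a b s : ℝ) : ℝ := min (a + max s 0) b

/-- The subtrajectory of `ω` associated with the interval `[a,b]`:
`(subPath ω a b)_s (t) = ω_{(a+s)∧b} (ζ_a + t)` for `0 ≤ t ≤ ζ_{(a+s)∧b} - ζ_a`.
(The lifetime is clamped at `0` to make the definition total; when
`ζ_a = ζ_b = min_{[a,b]} ζ` this is the usual subtrajectory.) -/
noncomputable def subPath (ω : ℝ → FinPath) (a b : ℝ) (s : ℝ) : FinPath where
  lifetime := max 0 ((ω (subIdx a b s)).lifetime - (ω a).lifetime)
  lifetime_nonneg := le_max_left _ _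
  toFun := fun t => (ω (subIdx a b s)).toFun ((ω a).lifetime +
    min (max t 0) (max 0 ((ω (subIdx a b s)).lifetime - (ω a).lifetime)))
  cont := by
    exact (ω (subIdx a b s)).cont.comp
      (continuous_const.add ((continuous_id.max continuous_const).min continuous_const))
  stopped := fun t => stop_aux _ _ _ (le_max_left 0 _) t

end Sub

namespace FinPath

lemma ext_of_lifetime_of_toFun {w w' : FinPath} (h : w.lifetime = w'.lifetime)
    (h' : ∀ t, w.toFun t = w'.toFun t) : w = w' := by
  cases w
  cases w'
  obtain rfl : _ = _ := h
  obtain rfl : _ = _ := funext h'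
  rfl

lemma bddAbove_range_abs_sub (w w' : FinPath) :
    BddAbove (Set.range fun t : ℝ => |w.toFun t - w'.toFun t|) := by
  have key : ∀ v : FinPath, ∃ C, ∀ t, |v.toFun t| ≤ C := by
    intro v
    obtain ⟨C, hC⟩ := (isCompact_Icc (a := (0 : ℝ)) (b := v.lifetime)).exists_bound_of_continuousOn
      v.cont.continuousOn
    refine ⟨C, fun t => ?_⟩
    rw [v.stopped t]
    exact hC _ ⟨le_min (le_max_right _ _) v.lifetime_nonneg, min_le_right _ _⟩
  obtain ⟨C, hC⟩ := key w
  obtain ⟨C', hC'⟩ := key w'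
  refine ⟨C + C', ?_⟩
  rintro _ ⟨t, rfl⟩
  exact (abs_sub _ _).trans (add_le_add (hC t) (hC' t))

lemma abs_lifetime_sub_le_dW (w w' : FinPath) : |w.lifetime - w'.lifetime| ≤ dW w w' :=
  le_add_of_nonneg_right (Real.iSup_nonneg fun _ => abs_nonneg _)

lemma abs_toFun_sub_le_dW (w w' : FinPath) (t : ℝ) : |w.toFun t - w'.toFun t| ≤ dW w w' :=
  (le_ciSup (bddAbove_range_abs_sub w w') t).trans (le_add_of_nonneg_left (abs_nonneg _))

lemma lifetime_le_tauStar_iff (y : ℝ) (w : FinPath) :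
    (w.lifetime : EReal) ≤ tauStar y w ↔ ∀ t, 0 < t → t < w.lifetime → w.toFun t ≠ y := by
  unfold tauStar
  rw [le_sInf_iff, Set.forall_mem_image]
  constructor
  · intro h t h0 ht hy
    exact absurd (EReal.coe_le_coe_iff.1 (h ⟨h0, ht.le, hy⟩)) (not_le.2 ht)
  · rintro h t ⟨h0, -, hy⟩
    exact EReal.coe_le_coe_iff.2 (not_lt.1 fun ht => h t h0 ht hy)

end FinPath

/-- The times at which the path has not hit `y` strictly before its lifetime. -/
def keptTimes (y : ℝ) (ω : ℝ → FinPath) : Set ℝ :=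
  {r | ((ω r).lifetime : EReal) ≤ FinPath.tauStar y (ω r)}

lemma mem_keptTimes {y : ℝ} {ω : ℝ → FinPath} {r : ℝ} :
    r ∈ keptTimes y ω ↔ ∀ t, 0 < t → t < (ω r).lifetime → (ω r).toFun t ≠ y :=
  FinPath.lifetime_le_tauStar_iff y (ω r)

lemma notMem_keptTimes {y : ℝ} {ω : ℝ → FinPath} {r : ℝ} :
    r ∉ keptTimes y ω ↔ ∃ t, 0 < t ∧ t < (ω r).lifetime ∧ (ω r).toFun t = y := by
  rw [mem_keptTimes]
  push Not
  rfl

namespace IsSnakeTraj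

variable {x y : ℝ} {ω : ℝ → FinPath}

lemma continuous_lifetime (hω : IsSnakeTraj x ω) : Continuous fun s => (ω s).lifetime := by
  rw [Metric.continuous_iff]
  intro s ε hε
  obtain ⟨δ, hδ, h⟩ := hω.cont s ε hε
  exact ⟨δ, hδ, fun s' hs' => (FinPath.abs_lifetime_sub_le_dW _ _).trans_lt (h s' hs')⟩

lemma toFun_eq_of_le (hω : IsSnakeTraj x ω) {s s' t : ℝ} (hs : s ≤ s') (ht : 0 ≤ t)
    (h : ∀ r ∈ Set.Icc s s', t ≤ (ω r).lifetime) : (ω s).toFun t = (ω s').toFun t := by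
  rcases le_or_gt 0 s with h0 | h0
  · refine hω.snake s s' h0 hs t ht (le_csInf ⟨_, s, ⟨le_rfl, hs⟩, rfl⟩ ?_)
    rintro _ ⟨r, hr, rfl⟩
    exact h r hr
  · have h1 := h s ⟨le_rfl, hs⟩
    rw [hω.init s h0.le] at h1
    obtain rfl : t = 0 := le_antisymm h1 ht
    rw [hω.start, hω.start]

lemma toFun_eq_of_uIcc (hω : IsSnakeTraj x ω) {s s' t : ℝ} (ht : 0 ≤ t)
    (h : ∀ r ∈ Set.uIcc s s', t ≤ (ω r).lifetime) : (ω s).toFun t = (ω s').toFun t := by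
  rcases le_total s s' with hs | hs
  · rw [Set.uIcc_of_le hs] at h
    exact hω.toFun_eq_of_le hs ht h
  · rw [Set.uIcc_of_ge hs] at h
    exact (hω.toFun_eq_of_le hs ht h).symm

lemma mem_keptTimes_of_nonpos (hω : IsSnakeTraj x ω) {s : ℝ} (hs : s ≤ 0) :
    s ∈ keptTimes y ω := by
  rw [mem_keptTimes, hω.init s hs]
  exact fun t h0 ht => absurd ht h0.le.not_gt

lemma isClosed_keptTimes (hω : IsSnakeTraj x ω) : IsClosed (keptTimes y ω) := by
  rw [← isOpen_compl_iff, Metric.isOpen_iff]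
  intro r hr
  obtain ⟨t, h0, ht, hy⟩ := notMem_keptTimes.1 hr
  obtain ⟨δ, hδ, h⟩ := Metric.continuous_iff.1 hω.continuous_lifetime r _ (sub_pos.2 ht)
  have hlt : ∀ q, dist q r < δ → t < (ω q).lifetime := fun q hq => by
    have := (abs_lt.1 (h q hq)).1
    linarith
  refine ⟨δ, hδ, fun r' hr' => notMem_keptTimes.2 ⟨t, h0, hlt r' hr', ?_⟩⟩
  rw [← hy]
  refine hω.toFun_eq_of_uIcc h0.le fun q hq => (hlt q ?_).le
  rw [Set.uIcc_comm] at hq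
  exact (Set.abs_sub_left_of_mem_uIcc hq).trans_lt hr'

lemma measurableSet_keptTimes (hω : IsSnakeTraj x ω) : MeasurableSet (keptTimes y ω) :=
  hω.isClosed_keptTimes.measurableSet

/-- A kept time that is a limit of discarded times has its tip at `y`. -/
lemma tip_eq_of_limit (hω : IsSnakeTraj x ω) {r₀ : ℝ} (hr₀ : r₀ ∈ keptTimes y ω)
    (hlim : r₀ ∈ closure (keptTimes y ω)ᶜ) : (ω r₀).tip = y := by
  by_contra hne
  unfold FinPath.tip at hne
  have hε : 0 < |(ω r₀).toFun (ω r₀).lifetime - y| := abs_pos.2 (sub_ne_zero.2 hne)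
  obtain ⟨δ₁, hδ₁, h₁⟩ := Metric.continuous_iff.1 (ω r₀).cont (ω r₀).lifetime _ (half_pos hε)
  obtain ⟨δ₂, hδ₂, h₂⟩ := hω.cont r₀ _ (lt_min (half_pos hε) hδ₁)
  obtain ⟨r, hr, hrd⟩ := Metric.mem_closure_iff.1 hlim δ₂ hδ₂
  rw [dist_comm, Real.dist_eq] at hrd
  obtain ⟨t, h0, ht, hy⟩ := notMem_keptTimes.1 hr
  have hζ : ∀ q ∈ Set.uIcc r r₀, |(ω q).lifetime - (ω r₀).lifetime| < δ₁ := fun q hq => by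
    rw [Set.uIcc_comm] at hq
    exact (FinPath.abs_lifetime_sub_le_dW _ _).trans_lt
      ((h₂ q ((Set.abs_sub_left_of_mem_uIcc hq).trans_lt hrd)).trans_le (min_le_right _ _))
  have htd : dist t (ω r₀).lifetime < δ₁ := by
    rw [Real.dist_eq, abs_lt]
    have hζr := abs_lt.1 (hζ r Set.left_mem_uIcc)
    refine ⟨?_, by linarith⟩
    by_contra hcon
    have hcon' : t ≤ (ω r₀).lifetime - δ₁ := by linarith
    refine mem_keptTimes.1 hr₀ t h0 (by linarith) ?_
    rw [← hy]
    refine (hω.toFun_eq_of_uIcc h0.le fun q hq => ?_).symm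
    have := (abs_lt.1 (hζ q hq)).1
    linarith
  have e₁ := h₁ t htd
  have e₂ := (FinPath.abs_toFun_sub_le_dW (ω r) (ω r₀) t).trans_lt
    ((h₂ r hrd).trans_le (min_le_left _ _))
  rw [hy, abs_sub_comm] at e₂
  rw [Real.dist_eq, abs_sub_comm] at e₁
  have := abs_sub_le ((ω r₀).toFun (ω r₀).lifetime) ((ω r₀).toFun t) y
  linarith

/-- If the discarded times are dense between `p` and a kept time `e`,
then the lifetime at `e` is at most the lifetime at `p`. -/
lemma lifetime_le_of_dense (hω : IsSnakeTraj x ω) {e p : ℝ} (he : e ∈ keptTimes y ω)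
    (hd : Set.uIcc p e ⊆ closure (keptTimes y ω)ᶜ) : (ω e).lifetime ≤ (ω p).lifetime := by
  by_contra! hlt
  obtain ⟨h, hph, hhe⟩ := exists_between hlt
  have h0 : 0 < h := (ω p).lifetime_nonneg.trans_lt hph
  have ivt : ∀ q, (ω q).lifetime ≤ h → ∃ g ∈ Set.uIcc q e, (ω g).lifetime = h := fun q hq =>
    intermediate_value_uIcc hω.continuous_lifetime.continuousOn
      (Set.mem_uIcc_of_le hq hhe.le)
  have hcpt : IsCompact (Set.uIcc p e ∩ {q | (ω q).lifetime = h}) :=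
    isCompact_uIcc.inter_right (isClosed_eq hω.continuous_lifetime continuous_const)
  obtain ⟨g, ⟨hge, hgh⟩, hmin⟩ := hcpt.exists_isMinOn
    (let ⟨g, hg, hg'⟩ := ivt p hph.le; ⟨g, hg, hg'⟩)
    (f := fun q => |e - q|) (by fun_prop)
  have hgh : (ω g).lifetime = h := hgh
  have hab : ∀ q ∈ Set.uIcc g e, h ≤ (ω q).lifetime := by
    intro q hq
    by_contra! hqh
    obtain ⟨g', hg', hg'h⟩ := ivt q hqh.le
    have hm : |e - g| ≤ |e - g'| := hmin ⟨Set.uIcc_subset_uIcc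
      (Set.uIcc_subset_uIcc hge Set.right_mem_uIcc hq) Set.right_mem_uIcc hg', hg'h⟩
    have hqg := Set.abs_sub_right_of_mem_uIcc hq
    have : g' = q := by
      rw [Set.mem_uIcc] at hg' hq
      grind
    rw [this] at hg'h
    exact hqh.ne hg'h
  have heq : ∀ t, 0 ≤ t → t ≤ h → (ω g).toFun t = (ω e).toFun t := fun t ht hth =>
    hω.toFun_eq_of_uIcc ht fun q hq => hth.trans (hab q hq)
  have hgZ : g ∈ keptTimes y ω := mem_keptTimes.2 fun t ht htg => by
    rw [heq t ht.le (htg.le.trans hgh.le)]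
    exact mem_keptTimes.1 he t ht (by linarith)
  refine mem_keptTimes.1 he h h0 hhe ?_
  rw [← heq h h0.le le_rfl, ← hω.tip_eq_of_limit hgZ (hd hge), FinPath.tip, hgh]

lemma intervalIntegrable_indicator (hω : IsSnakeTraj x ω) (a b : ℝ) :
    IntervalIntegrable ((keptTimes y ω).indicator fun _ => (1 : ℝ)) volume a b := by
  rw [intervalIntegrable_iff]
  exact (integrableOn_const (by simp)).indicator hω.measurableSet_keptTimes

lemma truncA_sub (hω : IsSnakeTraj x ω) (a b : ℝ) :
    truncA y ω b - truncA y ω a = ∫ r in a..b, (keptTimes y ω).indicator (fun _ => (1 : ℝ)) r :=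
  intervalIntegral.integral_interval_sub_left (hω.intervalIntegrable_indicator _ _)
    (hω.intervalIntegrable_indicator _ _)

lemma monotone_truncA (hω : IsSnakeTraj x ω) : Monotone (truncA y ω) := fun a b hab => by
  rw [← sub_nonneg, hω.truncA_sub]
  exact intervalIntegral.integral_nonneg hab fun r _ =>
    Set.indicator_nonneg (fun _ _ => zero_le_one) r

lemma truncA_sub_le (hω : IsSnakeTraj x ω) {a b : ℝ} (hab : a ≤ b) :
    truncA y ω b - truncA y ω a ≤ b - a := by
  rw [hω.truncA_sub]
  calc _ ≤ ∫ _ in a..b, (1 : ℝ) :=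
        intervalIntegral.integral_mono_on hab (hω.intervalIntegrable_indicator _ _)
          intervalIntegrable_const fun r _ => Set.indicator_le_self' (fun _ _ => zero_le_one) r
    _ = b - a := by simp

lemma continuous_truncA (hω : IsSnakeTraj x ω) : Continuous (truncA y ω) :=
  intervalIntegral.continuous_primitive hω.intervalIntegrable_indicator 0

lemma truncA_zero : truncA y ω 0 = 0 := intervalIntegral.integral_same

lemma truncA_sub_eq (hω : IsSnakeTraj x ω) {a b : ℝ} (hab : a ≤ b)
    (h : Set.Ioc a b ⊆ keptTimes y ω) : truncA y ω b - truncA y ω a = b - a := by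
  rw [hω.truncA_sub, intervalIntegral.integral_congr_ae (g := fun _ => (1 : ℝ))]
  · simp
  · refine Filter.Eventually.of_forall fun r hr => ?_
    rw [Set.uIoc_of_le hab] at hr
    exact Set.indicator_of_mem (h hr) _

lemma truncA_eq_of_disjoint (hω : IsSnakeTraj x ω) {a b : ℝ} (hab : a ≤ b)
    (h : ∀ r ∈ Set.Ioc a b, r ∉ keptTimes y ω) : truncA y ω b = truncA y ω a := by
  rw [← sub_eq_zero, hω.truncA_sub, intervalIntegral.integral_congr_ae (g := fun _ => (0 : ℝ))]
  · simp
  · refine Filter.Eventually.of_forall fun r hr => ?_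
    rw [Set.uIoc_of_le hab] at hr
    exact Set.indicator_of_notMem (h r hr) _

lemma exists_sub_le_truncA (hω : IsSnakeTraj x ω) :
    ∃ B : ℝ, (∀ s, B < s → ω s = FinPath.triv x) ∧ ∀ s, B ≤ s → s - B ≤ truncA y ω s := by
  obtain ⟨B, hB⟩ := hω.finite
  have htriv : ∀ s, max B 0 < s → ω s = FinPath.triv x := fun s hs => by
    by_contra hne
    exact ((hB hne).trans (le_max_left B 0)).not_gt hs
  refine ⟨max B 0, htriv, fun s hs => ?_⟩
  rw [← hω.truncA_sub_eq hs fun r hr => ?_]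
  · have := hω.monotone_truncA (y := y) (le_max_right B 0)
    rw [truncA_zero] at this
    linarith
  · rw [mem_keptTimes, htriv r hr.1]
    exact fun t h0 ht => absurd ht h0.le.not_gt

/-- Discarded times are dense in every interval on which `truncA` is constant. -/
lemma Icc_subset_closure_compl (hω : IsSnakeTraj x ω) {u v : ℝ} (huv : u < v)
    (hA : truncA y ω u = truncA y ω v) : Set.Icc u v ⊆ closure (keptTimes y ω)ᶜ := by
  rw [← closure_Ioo huv.ne]
  refine closure_minimal (fun r hr => ?_) isClosed_closure
  rw [Metric.mem_closure_iff]
  intro ε hε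
  by_contra! hcon
  obtain ⟨d, hrd, hd⟩ := exists_between (lt_min hr.2 (lt_add_of_pos_right r hε))
  have h1 := hω.truncA_sub_eq (y := y) hrd.le fun q hq => by
    by_contra hqZ
    have h2 := hcon q hqZ
    rw [dist_comm, Real.dist_eq, abs_of_pos (sub_pos.2 hq.1)] at h2
    linarith [hq.2, hd.trans_le (min_le_right _ _)]
  have h3 := hω.monotone_truncA (y := y) hr.1.le
  have h4 := hω.monotone_truncA (y := y) (hd.trans_le (min_le_left _ _)).le
  linarith

lemma lifetime_le_of_truncA_eq (hω : IsSnakeTraj x ω) {u v e q : ℝ}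
    (hA : truncA y ω u = truncA y ω v) (he : e ∈ keptTimes y ω)
    (heI : e ∈ Set.Icc u v) (hq : q ∈ Set.Icc u v) : (ω e).lifetime ≤ (ω q).lifetime := by
  rcases (heI.1.trans heI.2).eq_or_lt with rfl | huv
  · rw [le_antisymm heI.2 heI.1, le_antisymm hq.2 hq.1]
  · exact hω.lifetime_le_of_dense he
      ((Set.uIcc_subset_Icc hq heI).trans (hω.Icc_subset_closure_compl huv hA))

lemma eq_of_truncA_eq (hω : IsSnakeTraj x ω) {u v : ℝ} (huv : u ≤ v)
    (hA : truncA y ω u = truncA y ω v) (hu : u ∈ keptTimes y ω) (hv : v ∈ keptTimes y ω) :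
    ω u = ω v := by
  have hu' : u ∈ Set.Icc u v := ⟨le_rfl, huv⟩
  have hv' : v ∈ Set.Icc u v := ⟨huv, le_rfl⟩
  have hl : (ω u).lifetime = (ω v).lifetime :=
    le_antisymm (hω.lifetime_le_of_truncA_eq hA hu hu' hv')
      (hω.lifetime_le_of_truncA_eq hA hv hv' hu')
  refine FinPath.ext_of_lifetime_of_toFun hl fun t => ?_
  rw [(ω u).stopped, (ω v).stopped, hl]
  exact hω.toFun_eq_of_le huv (le_min (le_max_right _ _) (ω v).lifetime_nonneg) fun r hr =>
    (min_le_right _ _).trans (hω.lifetime_le_of_truncA_eq hA hv hv' hr)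

lemma nonempty_setOf_truncA_gt (hω : IsSnakeTraj x ω) (s : ℝ) :
    {r : ℝ | truncA y ω r > s}.Nonempty := by
  obtain ⟨B, -, hB⟩ := hω.exists_sub_le_truncA (y := y)
  refine ⟨B + (|s| + 1), ?_⟩
  have := hB (B + (|s| + 1)) (by linarith [abs_nonneg s])
  have := le_abs_self s
  show s < _
  linarith

lemma self_lt_of_lt_truncA (hω : IsSnakeTraj x ω) {r s : ℝ} (hs : 0 ≤ s)
    (h : s < truncA y ω r) : s < r := by
  rcases le_total r 0 with hr | hr
  · have := hω.monotone_truncA (y := y) hr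
    rw [truncA_zero] at this
    linarith
  · have := hω.truncA_sub_le (y := y) hr
    rw [truncA_zero] at this
    linarith

lemma bddBelow_setOf_truncA_gt (hω : IsSnakeTraj x ω) {s : ℝ} (hs : 0 ≤ s) :
    BddBelow {r : ℝ | truncA y ω r > s} :=
  ⟨s, fun _ hr => (hω.self_lt_of_lt_truncA hs hr).le⟩

lemma self_le_truncEta (hω : IsSnakeTraj x ω) {s : ℝ} (hs : 0 ≤ s) : s ≤ truncEta y ω s :=
  le_csInf (hω.nonempty_setOf_truncA_gt s) fun _ hr => (hω.self_lt_of_lt_truncA hs hr).le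

lemma lt_truncA_of_truncEta_lt (hω : IsSnakeTraj x ω) {r s : ℝ}
    (h : truncEta y ω s < r) : s < truncA y ω r := by
  obtain ⟨r', hr', hlt⟩ := exists_lt_of_csInf_lt (hω.nonempty_setOf_truncA_gt s) h
  exact lt_of_lt_of_le hr' (hω.monotone_truncA hlt.le)

lemma truncA_truncEta (hω : IsSnakeTraj x ω) {s : ℝ} (hs : 0 ≤ s) :
    truncA y ω (truncEta y ω s) = s := by
  refine le_antisymm (not_lt.1 fun h => ?_) ?_
  · obtain ⟨l, hl, hl'⟩ := exists_Ioc_subset_of_mem_nhds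
      (hω.continuous_truncA.continuousAt.eventually_mem (Ioi_mem_nhds h)) (exists_lt _)
    obtain ⟨r, hr, hr'⟩ := exists_between hl
    exact (csInf_le (hω.bddBelow_setOf_truncA_gt hs) (hl' ⟨hr, hr'.le⟩)).not_gt hr'
  · refine ge_of_tendsto (x := nhdsWithin (truncEta y ω s) (Set.Ioi (truncEta y ω s)))
      (hω.continuous_truncA.tendsto _ |>.mono_left nhdsWithin_le_nhds) ?_
    filter_upwards [self_mem_nhdsWithin] with r hr using (hω.lt_truncA_of_truncEta_lt hr).le

lemma truncEta_mem_keptTimes (hω : IsSnakeTraj x ω) {s : ℝ} (hs : 0 ≤ s) :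
    truncEta y ω s ∈ keptTimes y ω := by
  rw [← hω.isClosed_keptTimes.closure_eq, Metric.mem_closure_iff]
  intro ε hε
  by_contra! hcon
  obtain ⟨d, hd, hd'⟩ := exists_between (lt_add_of_pos_right (truncEta y ω s) hε)
  have h1 := hω.truncA_eq_of_disjoint (y := y) hd.le fun r hr hrZ => by
    have := hcon r hrZ
    rw [dist_comm, Real.dist_eq, abs_of_pos (sub_pos.2 hr.1)] at this
    linarith [hr.2]
  rw [hω.truncA_truncEta hs] at h1
  exact (hω.lt_truncA_of_truncEta_lt hd).ne' h1

lemma le_truncEta_truncA (hω : IsSnakeTraj x ω) (q : ℝ) : q ≤ truncEta y ω (truncA y ω q) :=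
  not_lt.1 fun h => (hω.lt_truncA_of_truncEta_lt h).false

lemma monotoneOn_truncEta (hω : IsSnakeTraj x ω) : MonotoneOn (truncEta y ω) (Set.Ici 0) :=
  fun _ hs s' _ hss' => csInf_le_csInf (hω.bddBelow_setOf_truncA_gt hs)
    (hω.nonempty_setOf_truncA_gt s') fun _ hr => lt_of_le_of_lt hss' hr

lemma truncA_nonneg (hω : IsSnakeTraj x ω) {q : ℝ} (hq : 0 ≤ q) : 0 ≤ truncA y ω q := by
  rw [← truncA_zero (y := y) (ω := ω)]
  exact hω.monotone_truncA hq

lemma apply_truncEta_truncA (hω : IsSnakeTraj x ω) {q : ℝ} (hq : 0 ≤ q)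
    (hqZ : q ∈ keptTimes y ω) : ω (truncEta y ω (truncA y ω q)) = ω q :=
  have h0 := hω.truncA_nonneg hq
  (hω.eq_of_truncA_eq (hω.le_truncEta_truncA q) (hω.truncA_truncEta h0).symm hqZ
    (hω.truncEta_mem_keptTimes h0)).symm

lemma lifetime_truncEta_truncA_le (hω : IsSnakeTraj x ω) {q : ℝ} (hq : 0 ≤ q) :
    (ω (truncEta y ω (truncA y ω q))).lifetime ≤ (ω q).lifetime := by
  have h0 := hω.truncA_nonneg (y := y) hq
  obtain ⟨u, ⟨huZ, -, huq⟩, hmax⟩ :=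
    ((isCompact_Icc (a := (0 : ℝ)) (b := q)).inter_left
      (hω.isClosed_keptTimes (y := y))).exists_isGreatest
      ⟨0, hω.mem_keptTimes_of_nonpos le_rfl, le_rfl, hq⟩
  have hA : truncA y ω q = truncA y ω u := hω.truncA_eq_of_disjoint huq fun r hr hrZ => by
    rcases le_total 0 r with hr0 | hr0
    · exact (hmax ⟨hrZ, hr0, hr.2⟩).not_gt hr.1
    · exact (hmax ⟨hω.mem_keptTimes_of_nonpos le_rfl, le_rfl, hq⟩).not_gt (hr.1.trans_le hr0)
  have hqη := hω.le_truncEta_truncA (y := y) q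
  exact hω.lifetime_le_of_truncA_eq (hA.symm.trans (hω.truncA_truncEta h0).symm)
    (hω.truncEta_mem_keptTimes h0) ⟨huq.trans hqη, le_rfl⟩ ⟨huq, hqη⟩

lemma trunc_of_nonpos (hω : IsSnakeTraj x ω) {s : ℝ} (hs : s ≤ 0) :
    trunc y ω s = FinPath.triv x := by
  have h := hω.apply_truncEta_truncA (y := y) le_rfl (hω.mem_keptTimes_of_nonpos le_rfl)
  rw [truncA_zero, hω.init 0 le_rfl] at h
  rw [trunc, max_eq_right hs, h]

lemma trunc_cont (hω : IsSnakeTraj x ω) (s ε : ℝ) (hε : 0 < ε) : ∃ δ > (0 : ℝ), ∀ s' : ℝ,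
    |s' - s| < δ → FinPath.dW (trunc y ω s') (trunc y ω s) < ε := by
  by_contra! hcon
  choose f hf hfε using fun n : ℕ => hcon (1 / ((n : ℝ) + 1)) (by positivity)
  have hf_tendsto : Filter.Tendsto f Filter.atTop (nhds s) :=
    tendsto_iff_dist_tendsto_zero.2 <| squeeze_zero (fun _ => dist_nonneg)
      (fun n => (hf n).le) tendsto_one_div_add_atTop_nhds_zero_nat
  have hmax : Filter.Tendsto (fun n => max (f n) 0) Filter.atTop (nhds (max s 0)) :=
    hf_tendsto.max tendsto_const_nhds
  have hmem : ∀ n, truncEta y ω (max (f n) 0) ∈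
      Set.Icc 0 (truncEta y ω (max (s + 1) 0)) ∩ keptTimes y ω := fun n => by
    have h0 : 0 ≤ max (f n) 0 := le_max_right _ _
    refine ⟨⟨h0.trans (hω.self_le_truncEta h0), hω.monotoneOn_truncEta h0
      (Set.mem_Ici.2 (le_max_right _ _))
      (max_le_max_right 0 ?_)⟩, hω.truncEta_mem_keptTimes h0⟩
    have h1 := (abs_lt.1 (hf n)).2
    have h2 : 1 / ((n : ℝ) + 1) ≤ 1 := by
      rw [div_le_one (by positivity)]
      linarith [n.cast_nonneg (α := ℝ)]
    linarith
  obtain ⟨q, ⟨hq, hqZ⟩, φ, hφ, hlim⟩ :=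
    (isCompact_Icc.inter_right hω.isClosed_keptTimes).tendsto_subseq hmem
  have hAq : truncA y ω q = max s 0 := by
    refine tendsto_nhds_unique ((hω.continuous_truncA.tendsto q).comp hlim) ?_
    refine (hmax.comp hφ.tendsto_atTop).congr fun n => ?_
    exact (hω.truncA_truncEta (le_max_right _ _)).symm
  have hωq : trunc y ω s = ω q := by
    rw [trunc, ← hAq, hω.apply_truncEta_truncA hq.1 hqZ]
  obtain ⟨δ, hδ, h⟩ := hω.cont q ε hε
  obtain ⟨N, hN⟩ := (Metric.tendsto_atTop.1 hlim δ hδ)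
  refine (hfε (φ N)).not_gt ?_
  rw [hωq]
  exact h _ (hN N le_rfl)

lemma trunc_snake (hω : IsSnakeTraj x ω) {s s' t : ℝ} (hs : 0 ≤ s) (hss' : s ≤ s') (ht : 0 ≤ t)
    (h : t ≤ sInf ((fun r => (trunc y ω r).lifetime) '' Set.Icc s s')) :
    (trunc y ω s).toFun t = (trunc y ω s').toFun t := by
  have hs' := hs.trans hss'
  rw [trunc, trunc, max_eq_left hs, max_eq_left hs']
  refine hω.toFun_eq_of_le (hω.monotoneOn_truncEta hs hs' hss') ht fun q hq => ?_
  have hq0 : 0 ≤ q := (hs.trans (hω.self_le_truncEta hs)).trans hq.1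
  have h1 := hω.monotone_truncA (y := y) hq.1
  have h2 := hω.monotone_truncA (y := y) hq.2
  rw [hω.truncA_truncEta hs] at h1
  rw [hω.truncA_truncEta hs'] at h2
  refine le_trans (h.trans (csInf_le ⟨0, ?_⟩ ⟨truncA y ω q, ⟨h1, h2⟩, rfl⟩)) ?_
  · rintro _ ⟨r, -, rfl⟩
    exact (trunc y ω r).lifetime_nonneg
  · simp only [trunc, max_eq_left (hs.trans h1)]
    exact hω.lifetime_truncEta_truncA_le hq0

end IsSnakeTraj

/-- **Truncation of a snake trajectory.** Let `x, y ∈ ℝ` and let `ω` be a snake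
trajectory with initial point `x`. With `A_s(ω) = ∫_0^s 1{ζ_r(ω) ≤ τ*_y(ω_r)} dr`
and `η_s(ω) = inf {r ≥ 0 : A_r(ω) > s}`, setting `ω'_s = ω_{η_s(ω)}` for every
`s ≥ 0` defines a snake trajectory with initial point `x`, the truncation
`tr_y(ω)` of `ω` at `y`. -/
theorem trunc_isSnakeTraj (x y : ℝ) (ω : ℝ → FinPath) (hω : IsSnakeTraj x ω) :
    IsSnakeTraj x (trunc y ω) := by
  obtain ⟨B, hB, -⟩ := hω.exists_sub_le_truncA (y := y)
  refine ⟨fun s hs => hω.trunc_of_nonpos hs, fun s => hω.start _, hω.trunc_cont,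
    ⟨B, fun s hs => not_lt.1 fun hBs => hs (hB _ ?_)⟩,
    fun s s' hs hss' t ht h => hω.trunc_snake hs hss' ht h⟩
  exact (hBs.trans_le (le_max_left s 0)).trans_le (hω.self_le_truncEta (le_max_right s 0))
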